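/- arXiv:2511.20538 — 5 statements merged into one kernel-verified Lean document; each statement's English description precedes it below -/
import Mathlib

section
/- Suppose E, B : ℝ × ℝ³ → ℝ³ are continuous, F : ℝ × ℝ³ × ℝ³ → ℝ is continuously differentiable, there is a compact set K ⊆ ℝ³ × ℝ³ such that F(t,x,v) = 0 whenever (x,v) ∉ K, and F satisfies the Vlasov equation with fields E and B. Then the continuity equation ∂t ρ_F(t,x) + ∇·J_F(t,x) = 0 holds for every (t,x) ∈ ℝ × ℝ³. (This is the compatibility condition by which the Gauss constraint ∇·E = ρ_F is preserved under the GNH algorithm in the Skinner–Rusk formulation of Maxwell–Vlasov.) -/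
noncomputable section

open MeasureTheory

/-- Physical space `ℝ³`, identified with `EuclideanSpace ℝ (Fin 3)`. -/
abbrev R3 : Type := EuclideanSpace ℝ (Fin 3)

/-- Euclidean dot product on `ℝ³`. -/
def dot (a b : R3) : ℝ := ∑ i, a i * b i

/-- Cross product on `ℝ³`. -/
def cross (a b : R3) : R3 :=
  (WithLp.equiv 2 (Fin 3 → ℝ)).symm
    ![a 1 * b 2 - a 2 * b 1, a 2 * b 0 - a 0 * b 2, a 0 * b 1 - a 1 * b 0]

/-- Time derivative `∂t` of a map on `ℝ × ℝ³`. -/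
def pt {E : Type*} [NormedAddCommGroup E] [NormedSpace ℝ E]
    (f : ℝ × R3 → E) (t : ℝ) (x : R3) : E :=
  fderiv ℝ (fun s => f (s, x)) t 1

/-- Spatial partial derivative in coordinate direction `i`. -/
def pd (i : Fin 3) (g : R3 → ℝ) (x : R3) : ℝ :=
  fderiv ℝ g x (EuclideanSpace.single i 1)

/-- Spatial gradient of a scalar function. -/
def grad (g : R3 → ℝ) (x : R3) : R3 :=
  (WithLp.equiv 2 (Fin 3 → ℝ)).symm (fun i => pd i g x)

/-- Spatial divergence of a vector field on `ℝ³`. -/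
def div3 (F : R3 → R3) (x : R3) : ℝ := ∑ i, pd i (fun y => F y i) x

/-- Spatial curl of a vector field on `ℝ³`. -/
def curl (F : R3 → R3) (x : R3) : R3 :=
  (WithLp.equiv 2 (Fin 3 → ℝ)).symm
    ![pd 1 (fun y => F y 2) x - pd 2 (fun y => F y 1) x,
      pd 2 (fun y => F y 0) x - pd 0 (fun y => F y 2) x,
      pd 0 (fun y => F y 1) x - pd 1 (fun y => F y 0) x]

/-- The Vlasov equation (unit charge) for a distribution `F` with fields `E`, `B`:
`∂tF + v·∇ₓF + (E + v × B)·∇ᵥF = 0`. -/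
def VlasovEq (E B : ℝ × R3 → R3) (F : ℝ × R3 × R3 → ℝ) : Prop :=
  ∀ (t : ℝ) (x v : R3),
    fderiv ℝ (fun s => F (s, x, v)) t 1
      + dot v (grad (fun y => F (t, y, v)) x)
      + dot (E (t, x) + cross v (B (t, x))) (grad (fun w => F (t, x, w)) v) = 0


/-- Differentiation under the integral sign for a `C¹` integrand that vanishes for `v` outside a
fixed compact set. -/
theorem fderiv_integral_apply_of_contDiff_of_isCompact {H V : Type*}
    [NormedAddCommGroup H] [NormedSpace ℝ H] [ProperSpace H]
    [NormedAddCommGroup V] [NormedSpace ℝ V] [MeasurableSpace V] [BorelSpace V]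
    [SecondCountableTopology V]
    {μ : Measure V} [IsFiniteMeasureOnCompacts μ] {G : H × V → ℝ} (hG : ContDiff ℝ 1 G)
    {K : Set V} (hK : IsCompact K) (hGK : ∀ h, ∀ v ∉ K, G (h, v) = 0) (h₀ u : H) :
    Integrable (fun v => fderiv ℝ (fun h => G (h, v)) h₀ u) μ ∧
      fderiv ℝ (fun h => ∫ v, G (h, v) ∂μ) h₀ u =
        ∫ v, fderiv ℝ (fun h => G (h, v)) h₀ u ∂μ := by
  set D : H → V → H →L[ℝ] ℝ := fun h v => fderiv ℝ (fun h => G (h, v)) h with hD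
  have hderiv : ∀ h v, HasFDerivAt (fun h => G (h, v)) (D h v) h := fun h v =>
    ((hG.comp (contDiff_id.prodMk contDiff_const)).differentiable one_ne_zero h).hasFDerivAt
  have hDcont : Continuous (Function.uncurry D) := by
    have key : Function.uncurry D =
        fun p : H × V => (fderiv ℝ G p).comp (ContinuousLinearMap.inl ℝ H V) := by
      funext ⟨h, v⟩
      exact (hderiv h v).unique
        ((hG.differentiable one_ne_zero (h, v)).hasFDerivAt.comp h (hasFDerivAt_prodMk_left h v))
    rw [key]
    exact (hG.continuous_fderiv one_ne_zero).clm_comp continuous_const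
  have hDK : ∀ h, ∀ v ∉ K, D h v = 0 := by
    intro h v hv
    simp [hD, hGK _ v hv]
  have hsupp : ∀ h, HasCompactSupport (D h) := fun h => HasCompactSupport.intro hK (hDK h)
  have hDint : ∀ h, Integrable (D h) μ := fun h =>
    (hDcont.comp (Continuous.prodMk_right h)).integrable_of_hasCompactSupport (hsupp h)
  have hGcont : ∀ h, Continuous fun v => G (h, v) := fun h =>
    hG.continuous.comp (Continuous.prodMk_right h)
  have hGint : ∀ h, Integrable (fun v => G (h, v)) μ := fun h =>
    (hGcont h).integrable_of_hasCompactSupport (HasCompactSupport.intro hK (hGK h))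
  obtain ⟨C, hC⟩ := ((isCompact_closedBall h₀ 1).prod hK).exists_bound_of_continuousOn
    hDcont.continuousOn
  have hbound : ∀ v, ∀ h ∈ Metric.closedBall h₀ 1, ‖D h v‖ ≤ K.indicator (fun _ => C) v := by
    intro v h hh
    by_cases hv : v ∈ K
    · simpa [hv] using hC (h, v) ⟨hh, hv⟩
    · simp [hv, hDK h v hv]
  have main := hasFDerivAt_integral_of_dominated_of_fderiv_le (μ := μ)
    (F := fun h v => G (h, v)) (F' := D) (x₀ := h₀) (bound := K.indicator fun _ => C)
    (Metric.closedBall_mem_nhds h₀ one_pos)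
    (.of_forall fun h => (hGint h).aestronglyMeasurable) (hGint h₀)
    (hDint h₀).aestronglyMeasurable (.of_forall hbound)
    ((integrable_indicator_iff hK.measurableSet).2
      (continuousOn_const.integrableOn_compact hK))
    (.of_forall fun v h _ => hderiv h v)
  refine ⟨(hDint h₀).apply_continuousLinearMap u, ?_⟩
  rw [main.fderiv, ContinuousLinearMap.integral_apply (hDint h₀)]

/-- Integration by parts against a coefficient that is constant along the direction of
differentiation. -/
theorem integral_mul_fderiv_eq_zero {V : Type*}
    [NormedAddCommGroup V] [NormedSpace ℝ V] [FiniteDimensional ℝ V]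
    [MeasurableSpace V] [BorelSpace V]
    {μ : Measure V} [μ.IsAddHaarMeasure] {a f : V → ℝ} (ha : ContDiff ℝ 1 a)
    (hf : ContDiff ℝ 1 f) (hfc : HasCompactSupport f) (u : V) (hau : ∀ v, fderiv ℝ a v u = 0) :
    Integrable (fun v => a v * fderiv ℝ f v u) μ ∧ ∫ v, a v * fderiv ℝ f v u ∂μ = 0 := by
  have hprod : Integrable (fun v => a v * fderiv ℝ f v u) μ := by
    refine Continuous.integrable_of_hasCompactSupport
      (ha.continuous.mul ((hf.continuous_fderiv one_ne_zero).clm_apply continuous_const)) ?_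
    exact (hfc.fderiv_apply (𝕜 := ℝ) u).mul_left
  refine ⟨hprod, ?_⟩
  rw [integral_mul_fderiv_eq_neg_fderiv_mul_of_integrable _ hprod _
    (fun v _ => ha.differentiable one_ne_zero v) (fun v _ => hf.differentiable one_ne_zero v)]
  · simp [hau]
  · simp [hau]
  · exact (ha.continuous.mul hf.continuous).integrable_of_hasCompactSupport hfc.mul_left

/-- The component `i` of the Lorentz force does not depend on `v i`. -/
theorem fderiv_lorentz_apply_single (e b v : R3) (i : Fin 3) :
    fderiv ℝ (fun w => (e + cross w b) i) v (EuclideanSpace.single i 1) = 0 := by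
  have hcoord : ∀ j : Fin 3, HasFDerivAt (fun w : R3 => w j)
      (EuclideanSpace.proj j : R3 →L[ℝ] ℝ) v := fun j =>
    (EuclideanSpace.proj j : R3 →L[ℝ] ℝ).hasFDerivAt
  have hlin : ∀ (j k : Fin 3) (c d r : ℝ), HasFDerivAt (fun w : R3 => r + (w j * c - w k * d))
      (c • (EuclideanSpace.proj j : R3 →L[ℝ] ℝ) - d • (EuclideanSpace.proj k : R3 →L[ℝ] ℝ)) v :=
    fun j k c d r => (((hcoord j).mul_const c).sub ((hcoord k).mul_const d)).const_add r
  fin_cases i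
  · simpa [cross] using congrArg (· (EuclideanSpace.single 0 1)) (hlin 1 2 (b 2) (b 1) (e 0)).fderiv
  · simpa [cross] using congrArg (· (EuclideanSpace.single 1 1)) (hlin 2 0 (b 0) (b 2) (e 1)).fderiv
  · simpa [cross] using congrArg (· (EuclideanSpace.single 2 1)) (hlin 0 1 (b 1) (b 0) (e 2)).fderiv

theorem contDiff_lorentz (e b : R3) (i : Fin 3) :
    ContDiff ℝ 1 fun w => (e + cross w b) i := by
  fin_cases i <;> simp [cross] <;> fun_prop

/-- If `E, B` are continuous fields, `F` is a `C¹` distribution function with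
compact support in `(x, v)` (uniformly in time) satisfying the Vlasov equation, then the
continuity equation `∂t ρ_F + ∇·J_F = 0` holds everywhere, where `ρ_F(t,x) = ∫ F(t,x,v) dv`
and `J_F(t,x) = ∫ v F(t,x,v) dv`. -/
theorem continuity_equation_of_vlasov
    (E B : ℝ × R3 → R3) (F : ℝ × R3 × R3 → ℝ)
    (hE : Continuous E) (hB : Continuous B)
    (hF : ContDiff ℝ 1 F)
    (hsupp : ∃ K : Set (R3 × R3), IsCompact K ∧
      ∀ (t : ℝ) (x v : R3), (x, v) ∉ K → F (t, x, v) = 0)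
    (hVlasov : VlasovEq E B F) :
    ∀ (t : ℝ) (x : R3),
      fderiv ℝ (fun s => ∫ v : R3, F (s, x, v)) t 1
        + div3 (fun y => ∫ v : R3, F (t, y, v) • v) x = 0 := by
  obtain ⟨K, hK, hFK⟩ := hsupp
  intro t x
  set K₂ : Set R3 := Prod.snd '' K
  have hK₂ : IsCompact K₂ := hK.image continuous_snd
  have hzero : ∀ s y, ∀ v ∉ K₂, F (s, y, v) = 0 := fun s y v hv =>
    hFK s y v fun h => hv ⟨(y, v), h, rfl⟩
  have hspace : ContDiff ℝ 1 fun p : R3 × R3 => F (t, p.1, p.2) := by fun_prop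
  obtain ⟨htint, ht⟩ := fderiv_integral_apply_of_contDiff_of_isCompact (μ := volume)
    (G := fun p : ℝ × R3 => F (p.1, x, p.2)) (by fun_prop) hK₂ (fun s => hzero s x) t 1
  have hx : ∀ i : Fin 3,
      Integrable (fun v : R3 => v i * pd i (fun y => F (t, y, v)) x) ∧
      pd i (fun y => (∫ v : R3, F (t, y, v) • v) i) x =
        ∫ v : R3, v i * pd i (fun y => F (t, y, v)) x := by
    intro i
    have hcoord : ∀ y, (∫ v : R3, F (t, y, v) • v) i = ∫ v : R3, v i * F (t, y, v) := by
      intro y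
      have hprod : Integrable fun v : R3 => F (t, y, v) • v :=
        Continuous.integrable_of_hasCompactSupport
          ((hspace.continuous.comp (Continuous.prodMk_right y)).smul continuous_id)
          (HasCompactSupport.intro hK₂ fun v hv => by simp [hzero t y v hv])
      have := (EuclideanSpace.proj i : R3 →L[ℝ] ℝ).integral_comp_comm hprod
      simpa [mul_comm] using this.symm
    have hderiv : ∀ v : R3, fderiv ℝ (fun y => v i * F (t, y, v)) x (EuclideanSpace.single i 1) =
        v i * pd i (fun y => F (t, y, v)) x := by
      intro v
      have hd : DifferentiableAt ℝ (fun y => F (t, y, v)) x :=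
        (hspace.comp (contDiff_id.prodMk contDiff_const)).differentiable one_ne_zero x
      rw [fderiv_const_mul hd]
      rfl
    have := fderiv_integral_apply_of_contDiff_of_isCompact (μ := volume)
      (G := fun p : R3 × R3 => p.2 i * F (t, p.1, p.2)) (by fun_prop) hK₂
      (fun y v hv => by simp [hzero t y v hv]) x (EuclideanSpace.single i 1)
    simp only [hderiv] at this
    simp only [hcoord]
    exact this
  have hv : ∀ i : Fin 3,
      Integrable (fun v : R3 => (E (t, x) + cross v (B (t, x))) i *
        pd i (fun w => F (t, x, w)) v) ∧
      ∫ v : R3, (E (t, x) + cross v (B (t, x))) i * pd i (fun w => F (t, x, w)) v = 0 := fun i =>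
    integral_mul_fderiv_eq_zero (contDiff_lorentz _ _ i) (by fun_prop)
      (HasCompactSupport.intro hK₂ (hzero t x)) _ (fun v => fderiv_lorentz_apply_single _ _ v i)
  have hsum : ∫ v : R3, (fderiv ℝ (fun s => F (s, x, v)) t 1
      + ∑ i, v i * pd i (fun y => F (t, y, v)) x
      + ∑ i, (E (t, x) + cross v (B (t, x))) i * pd i (fun w => F (t, x, w)) v) = 0 :=
    integral_eq_zero_of_ae (.of_forall fun v => hVlasov t x v)
  have hxint := integrable_finsetSum Finset.univ fun i _ => (hx i).1
  have hvint := integrable_finsetSum Finset.univ fun i _ => (hv i).1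
  have htxint : Integrable fun v : R3 => fderiv ℝ (fun s => F (s, x, v)) t 1
      + ∑ i, v i * pd i (fun y => F (t, y, v)) x := htint.add hxint
  rw [integral_add htxint hvint, integral_add htint hxint,
    integral_finsetSum _ fun i _ => (hx i).1, integral_finsetSum _ fun i _ => (hv i).1,
    Finset.sum_eq_zero fun i _ => (hv i).2, add_zero] at hsum
  rw [← hsum, ht, div3]
  exact congrArg _ (Finset.sum_congr rfl fun i _ => (hx i).2)
end
end

section
/- Suppose E, B : ℝ × ℝ³ → ℝ³ are continuous, F : ℝ × ℝ³ × ℝ³ → ℝ is continuously differentiable, there is a compact set K ⊆ ℝ³ × ℝ³ such that F(t,x,v) = 0 whenever (x,v) ∉ K, and F satisfies the Vlasov equation with fields E and B. Then the kinetic energy 𝒦(t) := ∫∫ ½|v|² F(t,x,v) dx dv is a differentiable function of t and satisfies the power balance 𝒦'(t) = ∫ E(t,x)·J_F(t,x) dx for every t. -/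
noncomputable section

open MeasureTheory

/-- A time-dependent `C¹` density supported in a fixed compact set may be differentiated
under the integral sign. -/
theorem hasDerivAt_integral_mul_of_compact_support {X : Type*} [NormedAddCommGroup X]
    [NormedSpace ℝ X] [MeasurableSpace X] [BorelSpace X] {μ : Measure X}
    [IsFiniteMeasureOnCompacts μ] {F : ℝ × X → ℝ} (hF : ContDiff ℝ 1 F) {K : Set X}
    (hK : IsCompact K) (hsupp : ∀ t, ∀ p ∉ K, F (t, p) = 0) {φ : X → ℝ} (hφ : Continuous φ)
    (t : ℝ) :
    HasDerivAt (fun s => ∫ p, φ p * F (s, p) ∂μ) (∫ p, φ p * fderiv ℝ F (t, p) (1, 0) ∂μ) t := by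
  have hderiv (s : ℝ) (p : X) :
      HasDerivAt (fun r => φ p * F (r, p)) (φ p * fderiv ℝ F (s, p) (1, 0)) s :=
    (((hF.differentiable one_ne_zero (s, p)).hasFDerivAt.comp_hasDerivAt s
      ((hasDerivAt_id s).prodMk (hasDerivAt_const s p)))).const_mul (φ p)
  have hcont : Continuous fun q : ℝ × X => φ q.2 * fderiv ℝ F q (1, 0) :=
    (hφ.comp continuous_snd).mul ((hF.continuous_fderiv one_ne_zero).clm_apply continuous_const)
  obtain ⟨C, hC⟩ :=
    ((isCompact_Icc (a := t - 1) (b := t + 1)).prod hK).exists_bound_of_continuousOn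
      hcont.continuousOn
  have hint (s : ℝ) : Continuous fun p => φ p * F (s, p) :=
    hφ.mul (hF.continuous.comp (by fun_prop))
  refine (hasDerivAt_integral_of_dominated_loc_of_deriv_le
    (F' := fun s p => φ p * fderiv ℝ F (s, p) (1, 0)) (bound := K.indicator fun _ => C)
    (Icc_mem_nhds (by linarith : t - 1 < t) (by linarith : t < t + 1))
    (.of_forall fun s => (hint s).aestronglyMeasurable)
    ((hint t).integrable_of_hasCompactSupport (.intro hK fun p hp => by simp [hsupp t p hp]))
    (hcont.comp (Continuous.prodMk_right t)).aestronglyMeasurable ?_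
    ((integrable_indicator_iff hK.measurableSet).2
      (integrableOn_const hK.measure_lt_top.ne))
    (.of_forall fun p s _ => hderiv s p)).2
  refine .of_forall fun p s hs => ?_
  by_cases hp : p ∈ K
  · simpa [hp] using hC (s, p) ⟨hs, hp⟩
  · have h0 := hderiv s p
    simp only [hsupp _ p hp, mul_zero] at h0
    simp [hp, h0.unique (hasDerivAt_const s 0)]

/-- Integration by parts along a direction in which the coefficient `c` is differentiable,
against a compactly supported `C¹` function. -/
theorem integral_mul_fderiv_eq_neg_of_hasLineDerivAt {X : Type*} [NormedAddCommGroup X]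
    [NormedSpace ℝ X] [FiniteDimensional ℝ X] [MeasurableSpace X] [BorelSpace X] {μ : Measure X}
    [μ.IsAddHaarMeasure] {G : X → ℝ} (hG : ContDiff ℝ 1 G) (hGc : HasCompactSupport G)
    {c c' : X → ℝ} (hc : Continuous c) (hc' : Continuous c') {d : X}
    (hd : ∀ p, HasLineDerivAt ℝ c (c' p) p d) :
    ∫ p, c p * fderiv ℝ G p d ∂μ = -∫ p, c' p * G p ∂μ :=
  integral_bilinear_hasLineDerivAt_right_eq_neg_left_of_integrable
    (B := ContinuousLinearMap.mul ℝ ℝ)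
    ((hc'.mul hG.continuous).integrable_of_hasCompactSupport hGc.mul_left)
    ((hc.mul ((hG.continuous_fderiv one_ne_zero).clm_apply
      continuous_const)).integrable_of_hasCompactSupport (hGc.fderiv_apply ℝ d).mul_left)
    ((hc.mul hG.continuous).integrable_of_hasCompactSupport hGc.mul_left)
    (fun p _ => hd p)
    (fun p _ => (hG.differentiable one_ne_zero p).hasFDerivAt.hasLineDerivAt d)

theorem dot_eq_inner (a b : R3) : dot a b = inner ℝ a b := by
  simp [dot, PiLp.inner_apply, mul_comm]

theorem continuous_dot {X : Type*} [TopologicalSpace X] {a b : X → R3} (ha : Continuous a)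
    (hb : Continuous b) : Continuous fun x => dot (a x) (b x) := by
  simp only [dot_eq_inner]
  exact ha.inner hb

theorem continuous_cross {X : Type*} [TopologicalSpace X] {a b : X → R3} (ha : Continuous a)
    (hb : Continuous b) : Continuous fun x => cross (a x) (b x) := by
  refine (PiLp.continuous_toLp 2 _).comp (continuous_pi fun i => ?_)
  fin_cases i <;> simp <;> fun_prop

theorem dot_add_cross_self (v e b : R3) : dot (e + cross v b) v = dot e v := by
  simp [dot, cross, Fin.sum_univ_three]
  ring

theorem cross_add_smul_single (v b : R3) (i : Fin 3) (s : ℝ) :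
    cross (v + s • EuclideanSpace.single i 1) b i = cross v b i := by
  fin_cases i <;> simp [cross]

theorem dot_self_add_smul_single (v : R3) (i : Fin 3) (s : ℝ) :
    dot (v + s • EuclideanSpace.single i 1) (v + s • EuclideanSpace.single i 1) =
      dot v v + 2 * s * v i + s ^ 2 := by
  fin_cases i <;> simp [dot, Fin.sum_univ_three] <;> ring

/-- Along the `i`-th velocity direction the `i`-th Lorentz force component is constant. -/
theorem hasLineDerivAt_energy_mul_lorentz (e b : R3 → R3) (i : Fin 3) (p : R3 × R3) :
    HasLineDerivAt ℝ
      (fun q : R3 × R3 => (1 / 2) * dot q.2 q.2 * (e q.1 + cross q.2 (b q.1)) i)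
      (p.2 i * (e p.1 + cross p.2 (b p.1)) i) p (0, EuclideanSpace.single i 1) := by
  have h : HasDerivAt (fun s : ℝ => (1 / 2) * (dot p.2 p.2 + 2 * s * p.2 i + s ^ 2) *
      (e p.1 + cross p.2 (b p.1)) i) (p.2 i * (e p.1 + cross p.2 (b p.1)) i) 0 := by
    refine HasDerivAt.mul_const ?_ _
    refine ((((((hasDerivAt_id (0 : ℝ)).const_mul 2).mul_const (p.2 i)).const_add
      (dot p.2 p.2)).add (hasDerivAt_pow 2 (0 : ℝ))).const_mul (1 / 2)).congr_deriv ?_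
    simp
  refine h.congr_of_eventuallyEq (.of_forall fun s => ?_)
  simp [dot_self_add_smul_single, cross_add_smul_single]

/-- The Vlasov equation in terms of the full derivative on `ℝ × ℝ³ × ℝ³`. -/
theorem VlasovEq.fderiv_time_eq {E B : ℝ × R3 → R3} {F : ℝ × R3 × R3 → ℝ}
    (h : VlasovEq E B F) (hF : ContDiff ℝ 1 F) (t : ℝ) (p : R3 × R3) :
    fderiv ℝ F (t, p) (1, 0) =
      -∑ i, (p.2 i * fderiv ℝ (fun q => F (t, q)) p (EuclideanSpace.single i 1, 0) +
        (E (t, p.1) + cross p.2 (B (t, p.1))) i *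
          fderiv ℝ (fun q => F (t, q)) p (0, EuclideanSpace.single i 1)) := by
  obtain ⟨x, v⟩ := p
  have hd := (hF.differentiable one_ne_zero (t, x, v)).hasFDerivAt
  have hG := ((hF.comp (contDiff_prodMk_right t)).differentiable one_ne_zero (x, v)).hasFDerivAt
  have ht := (hd.comp t (hasFDerivAt_prodMk_left (𝕜 := ℝ) t (x, v))).fderiv
  have hx := (hG.comp x (hasFDerivAt_prodMk_left (𝕜 := ℝ) x v)).fderiv
  have hv := (hG.comp v (hasFDerivAt_prodMk_right (𝕜 := ℝ) x v)).fderiv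
  have hV := h t x v
  simp only [Function.comp_def] at ht hx hv
  simp only [dot, grad, pd, ht, hx, hv, WithLp.equiv_symm_apply,
    ContinuousLinearMap.comp_apply, ContinuousLinearMap.inl_apply,
    ContinuousLinearMap.inr_apply] at hV
  rw [Finset.sum_add_distrib]
  linarith

/-- Under the hypotheses of the Vlasov system with continuous fields and a
compactly supported `C¹` distribution, the kinetic energy `𝒦(t) = ∫∫ ½|v|² F(t,x,v) dx dv`
is differentiable in `t` with derivative `𝒦'(t) = ∫ E(t,x)·J_F(t,x) dx`. -/
theorem kinetic_energy_power_balance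
    (E B : ℝ × R3 → R3) (F : ℝ × R3 × R3 → ℝ)
    (hE : Continuous E) (hB : Continuous B)
    (hF : ContDiff ℝ 1 F)
    (hsupp : ∃ K : Set (R3 × R3), IsCompact K ∧
      ∀ (t : ℝ) (x v : R3), (x, v) ∉ K → F (t, x, v) = 0)
    (hVlasov : VlasovEq E B F) :
    ∀ t : ℝ,
      HasDerivAt (fun s => ∫ p : R3 × R3, (1 / 2) * dot p.2 p.2 * F (s, p.1, p.2))
        (∫ x : R3, dot (E (t, x)) (∫ v : R3, F (t, x, v) • v)) t := by
  intro t
  obtain ⟨K, hK, h0⟩ := hsupp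
  have hEt : Continuous fun x => E (t, x) := hE.comp (by fun_prop)
  have hBt : Continuous fun x => B (t, x) := hB.comp (by fun_prop)
  set G : R3 × R3 → ℝ := fun q => F (t, q) with hGdef
  have hG : ContDiff ℝ 1 G := hF.comp (contDiff_prodMk_right t)
  have hGc : HasCompactSupport G := .intro hK fun p hp => h0 t p.1 p.2 hp
  have hdot : Continuous fun p : R3 × R3 => (1 / 2) * dot p.2 p.2 :=
    continuous_const.mul (continuous_dot continuous_snd continuous_snd)
  have hforce : Continuous fun p : R3 × R3 => E (t, p.1) + cross p.2 (B (t, p.1)) :=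
    (hEt.comp continuous_fst).add (continuous_cross continuous_snd (hBt.comp continuous_fst))
  have hcx (i : Fin 3) : Continuous fun p : R3 × R3 => (1 / 2) * dot p.2 p.2 * p.2 i :=
    hdot.mul (by fun_prop)
  have hcv (i : Fin 3) : Continuous fun p : R3 × R3 =>
      (1 / 2) * dot p.2 p.2 * (E (t, p.1) + cross p.2 (B (t, p.1))) i :=
    hdot.mul (by fun_prop)
  have hcv' (i : Fin 3) : Continuous fun p : R3 × R3 =>
      p.2 i * (E (t, p.1) + cross p.2 (B (t, p.1))) i := by fun_prop
  have hint {c : R3 × R3 → ℝ} (hc : Continuous c) (d : R3 × R3) :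
      Integrable fun p => c p * fderiv ℝ G p d :=
    (hc.mul ((hG.continuous_fderiv one_ne_zero).clm_apply
      continuous_const)).integrable_of_hasCompactSupport (hGc.fderiv_apply ℝ d).mul_left
  have hintG {c : R3 × R3 → ℝ} (hc : Continuous c) : Integrable fun p => c p * G p :=
    (hc.mul hG.continuous).integrable_of_hasCompactSupport hGc.mul_left
  have : (volume : Measure (R3 × R3)).IsAddHaarMeasure :=
    Measure.prod.instIsAddHaarMeasure volume volume
  have hx (i : Fin 3) : ∫ p : R3 × R3, (1 / 2) * dot p.2 p.2 * p.2 i *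
      fderiv ℝ G p (EuclideanSpace.single i 1, 0) = 0 := by
    rw [integral_mul_fderiv_eq_neg_of_hasLineDerivAt hG hGc (hcx i) (c' := fun _ => 0)
      continuous_const fun p => by
        simpa [HasLineDerivAt] using hasDerivAt_const (0 : ℝ) ((1 / 2) * dot p.2 p.2 * p.2 i)]
    simp
  have hv (i : Fin 3) := integral_mul_fderiv_eq_neg_of_hasLineDerivAt
    (μ := (volume : Measure (R3 × R3))) hG hGc (hcv i) (hcv' i)
    (hasLineDerivAt_energy_mul_lorentz (fun x => E (t, x)) (fun x => B (t, x)) i)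
  refine (hasDerivAt_integral_mul_of_compact_support hF hK (fun s p hp => h0 s p.1 p.2 hp)
    hdot t).congr_deriv ?_
  calc
    ∫ p : R3 × R3, (1 / 2) * dot p.2 p.2 * fderiv ℝ F (t, p) (1, 0)
      = ∫ p : R3 × R3, -∑ i, ((1 / 2) * dot p.2 p.2 * p.2 i *
            fderiv ℝ G p (EuclideanSpace.single i 1, 0) +
          (1 / 2) * dot p.2 p.2 * (E (t, p.1) + cross p.2 (B (t, p.1))) i *
            fderiv ℝ G p (0, EuclideanSpace.single i 1)) := by
        congr with p
        rw [hVlasov.fderiv_time_eq hF t p, mul_neg, Finset.mul_sum]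
        simp only [mul_add, mul_assoc, hGdef]
    _ = ∑ i, ∫ p : R3 × R3, p.2 i * (E (t, p.1) + cross p.2 (B (t, p.1))) i * G p := by
        rw [integral_neg, integral_finsetSum _ fun i _ => by
          exact (hint (hcx i) _).add (hint (hcv i) _), ← Finset.sum_neg_distrib]
        refine Finset.sum_congr rfl fun i _ => ?_
        rw [integral_add (hint (hcx i) _) (hint (hcv i) _), hx, hv, zero_add, neg_neg]
    _ = ∫ p : R3 × R3, dot (E (t, p.1)) p.2 * G p := by
        rw [← integral_finsetSum _ fun i _ => hintG (hcv' i)]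
        congr with p
        rw [← dot_add_cross_self p.2 (E (t, p.1)) (B (t, p.1)), dot, Finset.sum_mul]
        simp only [mul_comm (p.2 _)]
    _ = ∫ x : R3, ∫ v : R3, dot (E (t, x)) v * G (x, v) :=
        integral_prod _ (hintG (continuous_dot (hEt.comp continuous_fst) continuous_snd))
    _ = ∫ x : R3, dot (E (t, x)) (∫ v : R3, F (t, x, v) • v) := by
        congr with x
        have hFx : Continuous fun v => F (t, x, v) := hF.continuous.comp (by fun_prop)
        have hFc : HasCompactSupport fun v => F (t, x, v) :=
          .intro (hK.image continuous_snd) fun v hv => h0 t x v fun h => hv ⟨_, h, rfl⟩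
        have hFv : Integrable fun v => F (t, x, v) • v :=
          (hFx.smul continuous_id).integrable_of_hasCompactSupport hFc.smul_right
        rw [dot_eq_inner, ← integral_inner hFv]
        simp only [dot_eq_inner, inner_smul_right, hGdef, mul_comm]
end
end

section
/- Suppose E, B : ℝ × ℝ³ → ℝ³ are continuously differentiable, there is a compact set K' ⊆ ℝ³ such that E(t,x) = 0 and B(t,x) = 0 whenever x ∉ K'; suppose F : ℝ × ℝ³ × ℝ³ → ℝ is continuously differentiable, there is a compact set K ⊆ ℝ³ × ℝ³ such that F(t,x,v) = 0 whenever (x,v) ∉ K, and F satisfies the Vlasov equation with fields E and B; and suppose the coupled Maxwell equations ∂tB = −∇×E and ∂tE = ∇×B − J_F hold everywhere. Then the total Maxwell–Vlasov energy t ↦ ∫∫ ½|v|² F(t,x,v) dx dv + ½ ∫ (|E(t,x)|² + |B(t,x)|²) dx is constant on ℝ. (Conservation of the Maxwell–Vlasov Hamiltonian underlying the reduced Skinner–Rusk dynamics.) -/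
noncomputable section

open MeasureTheory

lemma integral_add_eq_zero {X : Type*} [MeasurableSpace X] {μ : Measure X} {f g : X → ℝ}
    (hf : Integrable f μ ∧ ∫ x, f x ∂μ = 0) (hg : Integrable g μ ∧ ∫ x, g x ∂μ = 0) :
    Integrable (fun x => f x + g x) μ ∧ ∫ x, (f x + g x) ∂μ = 0 :=
  ⟨hf.1.add hg.1, by rw [integral_add hf.1 hg.1, hf.2, hg.2, add_zero]⟩

lemma integral_sub_eq_zero {X : Type*} [MeasurableSpace X] {μ : Measure X} {f g : X → ℝ}
    (hf : Integrable f μ ∧ ∫ x, f x ∂μ = 0) (hg : Integrable g μ ∧ ∫ x, g x ∂μ = 0) :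
    Integrable (fun x => f x - g x) μ ∧ ∫ x, (f x - g x) ∂μ = 0 :=
  ⟨hf.1.sub hg.1, by rw [integral_sub hf.1 hg.1, hf.2, hg.2, sub_zero]⟩

lemma integral_sum_eq_zero {X ι : Type*} [Fintype ι] [MeasurableSpace X] {μ : Measure X}
    {f : ι → X → ℝ} (hf : ∀ i, Integrable (f i) μ ∧ ∫ x, f i x ∂μ = 0) :
    Integrable (fun x => ∑ i, f i x) μ ∧ ∫ x, ∑ i, f i x ∂μ = 0 :=
  ⟨integrable_finsetSum _ fun i _ => (hf i).1, by
    rw [integral_finsetSum _ fun i _ => (hf i).1, Finset.sum_eq_zero fun i _ => (hf i).2]⟩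

/-- A continuously differentiable integrand supported in a fixed compact set may be differentiated
under the integral sign. -/
lemma hasDerivAt_integral_of_contDiff_of_isCompact {V : Type*} [NormedAddCommGroup V]
    [NormedSpace ℝ V] [MeasurableSpace V] [BorelSpace V] {μ : Measure V}
    [IsFiniteMeasureOnCompacts μ] {g : ℝ × V → ℝ} (hg : ContDiff ℝ 1 g) {K : Set V}
    (hK : IsCompact K) (hgK : ∀ t x, x ∉ K → g (t, x) = 0) (t : ℝ) :
    HasDerivAt (fun s => ∫ x, g (s, x) ∂μ) (∫ x, deriv (fun s => g (s, x)) t ∂μ) t := by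
  have hline (s : ℝ) (x : V) :
      HasDerivAt (fun r => g (r, x)) (fderiv ℝ g (s, x) (1, 0)) s := by
    have h1 : HasFDerivAt g (fderiv ℝ g (s, x)) (s, x) :=
      (hg.differentiable one_ne_zero _).hasFDerivAt
    exact h1.comp_hasDerivAt s ((hasDerivAt_id s).prodMk (hasDerivAt_const s x))
  have hcont : Continuous fun p : ℝ × V => fderiv ℝ g p (1, 0) :=
    (hg.continuous_fderiv one_ne_zero).clm_apply continuous_const
  have hzero (s : ℝ) (x : V) (hx : x ∉ K) : fderiv ℝ g (s, x) (1, 0) = 0 := by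
    rw [← (hline s x).deriv]
    simp [hgK _ x hx]
  obtain ⟨C, hC⟩ := ((isCompact_Icc (a := t - 1) (b := t + 1)).prod hK).exists_bound_of_continuousOn
    hcont.continuousOn
  have hint (s : ℝ) {f : ℝ × V → ℝ} (hf : Continuous f) (hfK : ∀ x, x ∉ K → f (s, x) = 0) :
      Integrable (fun x => f (s, x)) μ :=
    (hf.comp (by fun_prop)).integrable_of_hasCompactSupport (HasCompactSupport.intro hK hfK)
  have key := (hasDerivAt_integral_of_dominated_loc_of_deriv_le (μ := μ) (x₀ := t)
    (s := Set.Icc (t - 1) (t + 1)) (F := fun s x => g (s, x))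
    (F' := fun s x => fderiv ℝ g (s, x) (1, 0)) (bound := K.indicator fun _ => C)
    (Icc_mem_nhds (by linarith) (by linarith))
    (Filter.Eventually.of_forall fun s => (hint s hg.continuous (hgK s)).aestronglyMeasurable)
    (hint t hg.continuous (hgK t))
    (hint t hcont (hzero t)).aestronglyMeasurable
    (Filter.Eventually.of_forall fun x s hs => by
      by_cases hx : x ∈ K
      · simpa [hx] using hC (s, x) ⟨hs, hx⟩
      · simp [hx, hzero s x hx])
    ((integrable_indicator_iff hK.measurableSet).2
      (integrableOn_const hK.measure_lt_top.ne))
    (Filter.Eventually.of_forall fun x s _ => hline s x)).2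
  simpa only [(hline t _).deriv] using key

/-- Integration by parts in the direction `w`, in divergence form. -/
lemma integral_mul_fderiv_add_fderiv_mul_eq_zero {V : Type*} [NormedAddCommGroup V]
    [NormedSpace ℝ V] [FiniteDimensional ℝ V] [MeasurableSpace V] [BorelSpace V] {μ : Measure V}
    [μ.IsAddHaarMeasure] {a b : V → ℝ} (ha : ContDiff ℝ 1 a) (hb : ContDiff ℝ 1 b)
    (hbs : HasCompactSupport b) (w : V) :
    Integrable (fun p => a p * fderiv ℝ b p w + fderiv ℝ a p w * b p) μ ∧
      ∫ p, (a p * fderiv ℝ b p w + fderiv ℝ a p w * b p) ∂μ = 0 := by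
  have ca : Continuous fun p => fderiv ℝ a p w :=
    (ha.continuous_fderiv one_ne_zero).clm_apply continuous_const
  have cb : Continuous fun p => fderiv ℝ b p w :=
    (hb.continuous_fderiv one_ne_zero).clm_apply continuous_const
  have i1 : Integrable (fun p => a p * fderiv ℝ b p w) μ :=
    (ha.continuous.mul cb).integrable_of_hasCompactSupport (hbs.fderiv_apply ℝ w).mul_left
  have i2 : Integrable (fun p => fderiv ℝ a p w * b p) μ :=
    (ca.mul hb.continuous).integrable_of_hasCompactSupport hbs.mul_left
  have i3 : Integrable (fun p => a p * b p) μ :=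
    (ha.continuous.mul hb.continuous).integrable_of_hasCompactSupport hbs.mul_left
  refine ⟨i1.add i2, ?_⟩
  rw [integral_add i1 i2, integral_mul_fderiv_eq_neg_fderiv_mul_of_integrable i2 i1 i3
    (fun x _ => ha.differentiable one_ne_zero x) (fun x _ => hb.differentiable one_ne_zero x)]
  ring

lemma pd_slice_left {g : R3 × R3 → ℝ} (hg : Differentiable ℝ g) (i : Fin 3) (x v : R3) :
    pd i (fun y => g (y, v)) x = fderiv ℝ g (x, v) (EuclideanSpace.single i 1, 0) := by
  have hg' : HasFDerivAt g (fderiv ℝ g (x, v)) ((fun e => (e, v)) x) := (hg (x, v)).hasFDerivAt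
  have h := (hg'.comp x (hasFDerivAt_prodMk_left (𝕜 := ℝ) x v)).fderiv
  have h' := congrArg (fun L => L (EuclideanSpace.single i (1 : ℝ))) h
  simpa [pd, Function.comp_def] using h'

lemma pd_slice_right {g : R3 × R3 → ℝ} (hg : Differentiable ℝ g) (i : Fin 3) (x v : R3) :
    pd i (fun w => g (x, w)) v = fderiv ℝ g (x, v) (0, EuclideanSpace.single i 1) := by
  have hg' : HasFDerivAt g (fderiv ℝ g (x, v)) ((fun e => (x, e)) v) := (hg (x, v)).hasFDerivAt
  have h := (hg'.comp v (hasFDerivAt_prodMk_right (𝕜 := ℝ) x v)).fderiv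
  have h' := congrArg (fun L => L (EuclideanSpace.single i (1 : ℝ))) h
  simpa [pd, Function.comp_def] using h'

lemma dot_eq (a b : R3) : dot a b = a 0 * b 0 + a 1 * b 1 + a 2 * b 2 := by
  simp [dot, Fin.sum_univ_three]

lemma contDiff_dot {V : Type*} [NormedAddCommGroup V] [NormedSpace ℝ V] {f g : V → R3}
    (hf : ContDiff ℝ 1 f) (hg : ContDiff ℝ 1 g) : ContDiff ℝ 1 fun p => dot (f p) (g p) := by
  unfold dot
  fun_prop

lemma contDiff_cross {V : Type*} [NormedAddCommGroup V] [NormedSpace ℝ V] {f g : V → R3}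
    (hf : ContDiff ℝ 1 f) (hg : ContDiff ℝ 1 g) : ContDiff ℝ 1 fun p => cross (f p) (g p) := by
  rw [contDiff_euclidean]
  intro i
  fin_cases i <;> simp [cross] <;> fun_prop

lemma fderiv_kinetic_mul_velocity (i : Fin 3) (x v : R3) :
    fderiv ℝ (fun p : R3 × R3 => 1 / 2 * dot p.2 p.2 * p.2 i) (x, v)
      (EuclideanSpace.single i 1, 0) = 0 := by
  have hd : ContDiff ℝ 1 (fun p : R3 × R3 => 1 / 2 * dot p.2 p.2 * p.2 i) := by
    have := contDiff_dot (contDiff_snd (𝕜 := ℝ) (E := R3) (F := R3)) contDiff_snd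
    fun_prop
  rw [← (hd.differentiable one_ne_zero _).lineDeriv_eq_fderiv]
  simp [lineDeriv]

lemma fderiv_kinetic_mul_force {E B : R3 → R3} (hE : ContDiff ℝ 1 E) (hB : ContDiff ℝ 1 B)
    (i : Fin 3) (x v : R3) :
    fderiv ℝ (fun p : R3 × R3 => 1 / 2 * dot p.2 p.2 * (E p.1 + cross p.2 (B p.1)) i) (x, v)
      (0, EuclideanSpace.single i 1) = v i * (E x + cross v (B x)) i := by
  have hd : ContDiff ℝ 1
      (fun p : R3 × R3 => 1 / 2 * dot p.2 p.2 * (E p.1 + cross p.2 (B p.1)) i) := by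
    have := contDiff_dot (contDiff_snd (𝕜 := ℝ) (E := R3) (F := R3)) contDiff_snd
    have := contDiff_cross (contDiff_snd (𝕜 := ℝ) (E := R3) (F := R3))
      (hB.comp contDiff_fst)
    simp only [Function.comp_def] at this
    fun_prop
  rw [← (hd.differentiable one_ne_zero _).lineDeriv_eq_fderiv]
  have hs : ∀ s : ℝ, 1 / 2 * dot (v + s • EuclideanSpace.single i 1)
      (v + s • EuclideanSpace.single i 1) *
        (E x + cross (v + s • EuclideanSpace.single i 1) (B x)) i =
      (1 / 2 * dot v v + s * v i + 1 / 2 * s ^ 2) * (E x + cross v (B x)) i := by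
    intro s
    fin_cases i <;> simp [dot_eq, cross, -mul_eq_mul_right_iff] <;> ring
  have hder : HasDerivAt (fun s : ℝ => (1 / 2 * dot v v + s * v i + 1 / 2 * s ^ 2) *
      (E x + cross v (B x)) i) (v i * (E x + cross v (B x)) i) 0 := by
    have := (((hasDerivAt_id (0 : ℝ)).mul_const (v i)).const_add (1 / 2 * dot v v)).add
      ((hasDerivAt_pow 2 (0 : ℝ)).const_mul (1 / 2))
    simpa using this.mul_const ((E x + cross v (B x)) i)
  rw [lineDeriv]
  simp only [Prod.mk_add_mk, Prod.smul_mk, smul_zero, add_zero, hs]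
  exact hder.deriv

/-- The power delivered to the particles equals the work of the electric field. -/
lemma kinetic_power_balance {E B : R3 → R3} (hE : ContDiff ℝ 1 E) (hB : ContDiff ℝ 1 B)
    {f : R3 × R3 → ℝ} (hf : ContDiff ℝ 1 f) (hfs : HasCompactSupport f) {fdot : R3 × R3 → ℝ}
    (h : ∀ x v, fdot (x, v) + dot v (grad (fun y => f (y, v)) x)
      + dot (E x + cross v (B x)) (grad (fun w => f (x, w)) v) = 0) :
    Integrable (fun x => dot (E x) (∫ v, f (x, v) • v)) ∧
      ∫ p : R3 × R3, 1 / 2 * dot p.2 p.2 * fdot p = ∫ x, dot (E x) (∫ v, f (x, v) • v) := by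
  have hfd : Differentiable ℝ f := hf.differentiable one_ne_zero
  have hq := contDiff_dot (contDiff_snd (𝕜 := ℝ) (E := R3) (F := R3)) contDiff_snd
  have hL : ContDiff ℝ 1 fun p : R3 × R3 => E p.1 + cross p.2 (B p.1) :=
    (hE.comp contDiff_fst).add (contDiff_cross contDiff_snd (hB.comp contDiff_fst))
  have : (volume : Measure (R3 × R3)).IsAddHaarMeasure := by
    rw [Measure.volume_eq_prod]
    infer_instance
  have hA (i : Fin 3) := integral_mul_fderiv_add_fderiv_mul_eq_zero (μ := volume)
    (a := fun p : R3 × R3 => 1 / 2 * dot p.2 p.2 * p.2 i) (by fun_prop) hf hfs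
    (EuclideanSpace.single i 1, 0)
  have hC (i : Fin 3) := integral_mul_fderiv_add_fderiv_mul_eq_zero (μ := volume)
    (a := fun p : R3 × R3 => 1 / 2 * dot p.2 p.2 * (E p.1 + cross p.2 (B p.1)) i)
    (by fun_prop) hf hfs (0, EuclideanSpace.single i 1)
  have hW : Integrable (fun p : R3 × R3 => dot (E p.1) p.2 * f p) := by
    have := contDiff_dot (hE.comp (contDiff_fst (F := R3))) contDiff_snd
    exact (this.continuous.mul hf.continuous).integrable_of_hasCompactSupport hfs.mul_left
  have hpt : (fun p : R3 × R3 => 1 / 2 * dot p.2 p.2 * fdot p) = fun p => dot (E p.1) p.2 * f p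
      - ((∑ i, (1 / 2 * dot p.2 p.2 * p.2 i * fderiv ℝ f p (EuclideanSpace.single i 1, 0)
        + fderiv ℝ (fun p : R3 × R3 => 1 / 2 * dot p.2 p.2 * p.2 i) p
          (EuclideanSpace.single i 1, 0) * f p))
      + ∑ i, (1 / 2 * dot p.2 p.2 * (E p.1 + cross p.2 (B p.1)) i
          * fderiv ℝ f p (0, EuclideanSpace.single i 1)
        + fderiv ℝ (fun p : R3 × R3 => 1 / 2 * dot p.2 p.2 * (E p.1 + cross p.2 (B p.1)) i) p
          (0, EuclideanSpace.single i 1) * f p)) := by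
    ext ⟨x, v⟩
    have hv := h x v
    simp only [fderiv_kinetic_mul_velocity, fderiv_kinetic_mul_force hE hB,
      ← pd_slice_left hfd, ← pd_slice_right hfd]
    simp only [dot_eq, grad, Fin.sum_univ_three] at hv ⊢
    simp [cross] at hv ⊢
    linear_combination (1 / 2 * (v 0 * v 0 + v 1 * v 1 + v 2 * v 2)) * hv
  have hN := integral_add_eq_zero (integral_sum_eq_zero hA) (integral_sum_eq_zero hC)
  have hinner (x : R3) : ∫ v, dot (E x) v * f (x, v) = dot (E x) (∫ v, f (x, v) • v) := by
    have hv : Integrable fun v => f (x, v) • v := by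
      refine Continuous.integrable_of_hasCompactSupport (by have := hf.continuous; fun_prop) ?_
      refine HasCompactSupport.intro (hfs.isCompact.image continuous_snd) fun v hv => ?_
      rw [image_eq_zero_of_notMem_tsupport fun hx => hv ⟨(x, v), hx, rfl⟩, zero_smul]
    have hdot (a b : R3) : dot a b = inner ℝ a b := by
      simp [dot, PiLp.inner_apply, mul_comm]
    simp only [hdot]
    rw [← integral_inner hv]
    simp [inner_smul_right, mul_comm]
  rw [hpt, integral_sub hW hN.1, hN.2, sub_zero, Measure.volume_eq_prod, integral_prod _ hW]
  simp only [← hinner]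
  exact ⟨hW.integral_prod_left, trivial⟩

/-- The integral form of the cross-product divergence identity `∇·(E × B) = B·∇×E − E·∇×B`. -/
lemma integral_dot_curl_sub {E B : R3 → R3} (hE : ContDiff ℝ 1 E) (hB : ContDiff ℝ 1 B)
    (hBs : HasCompactSupport B) :
    Integrable (fun x => dot (E x) (curl B x) - dot (B x) (curl E x)) ∧
      ∫ x, (dot (E x) (curl B x) - dot (B x) (curl E x)) = 0 := by
  have hP (i j k : Fin 3) := integral_mul_fderiv_add_fderiv_mul_eq_zero (μ := volume)
    (a := fun x => E x j) (b := fun x => B x k) (by fun_prop) (by fun_prop)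
    (hBs.comp_left (g := fun y : R3 => y k) rfl) (EuclideanSpace.single i 1)
  have hpt : (fun x => dot (E x) (curl B x) - dot (B x) (curl E x)) = fun x =>
      ∑ i : Fin 3, ((E x (i + 2) * fderiv ℝ (fun y => B y (i + 1)) x (EuclideanSpace.single i 1)
        + fderiv ℝ (fun y => E y (i + 2)) x (EuclideanSpace.single i 1) * B x (i + 1))
      - (E x (i + 1) * fderiv ℝ (fun y => B y (i + 2)) x (EuclideanSpace.single i 1)
        + fderiv ℝ (fun y => E y (i + 1)) x (EuclideanSpace.single i 1) * B x (i + 2))) := by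
    ext x
    simp [dot_eq, curl, pd, Fin.sum_univ_three]
    ring
  rw [hpt]
  exact integral_sum_eq_zero fun i => integral_sub_eq_zero (hP i _ _) (hP i _ _)

/-- For the coupled Maxwell–Vlasov system with `C¹` compactly supported fields
`E, B`, a `C¹` compactly supported distribution `F` satisfying the Vlasov equation, and the
Maxwell evolution equations `∂tB = −∇×E`, `∂tE = ∇×B − J_F`, the total energy
`t ↦ ∫∫ ½|v|² F dx dv + ½∫(|E|² + |B|²) dx` is constant on `ℝ`. -/
theorem maxwell_vlasov_energy_conservation
    (E B : ℝ × R3 → R3) (F : ℝ × R3 × R3 → ℝ)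
    (hE : ContDiff ℝ 1 E) (hB : ContDiff ℝ 1 B)
    (hEBsupp : ∃ K' : Set R3, IsCompact K' ∧
      ∀ (t : ℝ) (x : R3), x ∉ K' → E (t, x) = 0 ∧ B (t, x) = 0)
    (hF : ContDiff ℝ 1 F)
    (hsupp : ∃ K : Set (R3 × R3), IsCompact K ∧
      ∀ (t : ℝ) (x v : R3), (x, v) ∉ K → F (t, x, v) = 0)
    (hVlasov : VlasovEq E B F)
    (hFaraday : ∀ (t : ℝ) (x : R3), pt B t x = - curl (fun y => E (t, y)) x)
    (hAmpere : ∀ (t : ℝ) (x : R3),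
      pt E t x = curl (fun y => B (t, y)) x - ∫ v : R3, F (t, x, v) • v) :
    ∀ t₁ t₂ : ℝ,
      (∫ p : R3 × R3, (1 / 2) * dot p.2 p.2 * F (t₁, p.1, p.2))
          + (1 / 2) * ∫ x : R3, (dot (E (t₁, x)) (E (t₁, x)) + dot (B (t₁, x)) (B (t₁, x)))
      = (∫ p : R3 × R3, (1 / 2) * dot p.2 p.2 * F (t₂, p.1, p.2))
          + (1 / 2) * ∫ x : R3, (dot (E (t₂, x)) (E (t₂, x)) + dot (B (t₂, x)) (B (t₂, x))) := by
  obtain ⟨K', hK', hEB⟩ := hEBsupp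
  obtain ⟨K, hK, hFK⟩ := hsupp
  have hvv := contDiff_dot (contDiff_snd (𝕜 := ℝ) (E := R3) (F := R3)) contDiff_snd
  have hkin (t : ℝ) := hasDerivAt_integral_of_contDiff_of_isCompact (μ := volume)
    (g := fun q : ℝ × R3 × R3 => (1 / 2) * dot q.2.2 q.2.2 * F (q.1, q.2.1, q.2.2))
    ((contDiff_const.mul (hvv.comp contDiff_snd)).mul hF) hK
    (fun s p hp => by simp [hFK s p.1 p.2 hp]) t
  have hfield (t : ℝ) := hasDerivAt_integral_of_contDiff_of_isCompact (μ := volume)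
    (g := fun q : ℝ × R3 => dot (E (q.1, q.2)) (E (q.1, q.2)) + dot (B (q.1, q.2)) (B (q.1, q.2)))
    ((contDiff_dot hE hE).add (contDiff_dot hB hB)) hK'
    (fun s x hx => by simp [(hEB s x hx).1, (hEB s x hx).2, dot_eq]) t
  have hslice (t : ℝ) : ContDiff ℝ 1 fun p : R3 × R3 => F (t, p) := by fun_prop
  have hEt (t : ℝ) : ContDiff ℝ 1 fun x => E (t, x) := by fun_prop
  have hBt (t : ℝ) : ContDiff ℝ 1 fun x => B (t, x) := by fun_prop
  have hFs (t : ℝ) : HasCompactSupport fun p : R3 × R3 => F (t, p) :=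
    HasCompactSupport.intro hK fun p hp => hFK t p.1 p.2 hp
  have hBs (t : ℝ) : HasCompactSupport fun x => B (t, x) :=
    HasCompactSupport.intro hK' fun x hx => (hEB t x hx).2
  have hpower (t : ℝ) := kinetic_power_balance (hEt t) (hBt t) (hslice t) (hFs t)
    (fdot := fun p => fderiv ℝ (fun s => F (s, p)) t 1) fun x v => hVlasov t x v
  have hkin' (t : ℝ) :
      ∫ p : R3 × R3, deriv (fun s => (1 / 2) * dot p.2 p.2 * F (s, p.1, p.2)) t
        = ∫ x, dot (E (t, x)) (∫ v, F (t, x, v) • v) := by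
    rw [← (hpower t).2]
    congr 1 with p
    have hd : DifferentiableAt ℝ (fun s => F (s, p)) t :=
      (by fun_prop : ContDiff ℝ 1 fun s => F (s, p)).differentiable one_ne_zero t
    exact (hd.hasDerivAt.const_mul _).deriv
  have hfield' (t : ℝ) :
      ∫ x, deriv (fun s => dot (E (s, x)) (E (s, x)) + dot (B (s, x)) (B (s, x))) t
        = - (2 * ∫ x, dot (E (t, x)) (∫ v, F (t, x, v) • v)) := by
    have hcurl := integral_dot_curl_sub (hEt t) (hBt t) (hBs t)
    have hpt (x : R3) :
        deriv (fun s => dot (E (s, x)) (E (s, x)) + dot (B (s, x)) (B (s, x))) t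
          = 2 * ((dot (E (t, x)) (curl (fun y => B (t, y)) x)
              - dot (B (t, x)) (curl (fun y => E (t, y)) x))
            - dot (E (t, x)) (∫ v, F (t, x, v) • v)) := by
      have hline {A : ℝ × R3 → R3} (hA : ContDiff ℝ 1 A) :
          HasDerivAt (fun s => dot (A (s, x)) (A (s, x))) (2 * dot (A (t, x)) (pt A t x)) t := by
        have hd : HasDerivAt (fun s => A (s, x)) (pt A t x) t :=
          ((by fun_prop : ContDiff ℝ 1 fun s => A (s, x)).differentiable
            one_ne_zero t).hasDerivAt
        have hi (i : Fin 3) : HasDerivAt (fun s => A (s, x) i) (pt A t x i) t :=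
          (EuclideanSpace.proj i : R3 →L[ℝ] ℝ).hasFDerivAt.comp_hasDerivAt t hd
        have := (((hi 0).mul (hi 0)).add ((hi 1).mul (hi 1))).add ((hi 2).mul (hi 2))
        simp only [dot_eq]
        exact this.congr_deriv (by ring)
      refine ((hline hE).add (hline hB)).deriv.trans ?_
      rw [hFaraday, hAmpere]
      simp [dot_eq]
      ring
    simp only [hpt]
    rw [integral_const_mul, integral_sub hcurl.1 (hpower t).1, hcurl.2]
    ring
  refine is_const_of_deriv_eq_zero (f := fun t =>
    (∫ p : R3 × R3, (1 / 2) * dot p.2 p.2 * F (t, p.1, p.2))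
      + (1 / 2) * ∫ x : R3, (dot (E (t, x)) (E (t, x)) + dot (B (t, x)) (B (t, x))))
    (fun t => ((hkin t).add ((hfield t).const_mul _)).differentiableAt) fun t => ?_
  refine ((hkin t).add ((hfield t).const_mul (1 / 2))).deriv.trans ?_
  rw [hkin', hfield']
  ring
end
end

section
/- Let E, B : ℝ³ → ℝ³ be differentiable and define the Lorentz-force phase-space vector field X : ℝ³ × ℝ³ → ℝ³ × ℝ³ by X(x,v) := (v, E(x) + v × B(x)). Then X is differentiable at every point and divergence-free: for every (x,v), the trace of the Fréchet derivative DX(x,v), viewed as a linear endomorphism of ℝ³ × ℝ³ ≅ ℝ⁶, equals zero. (This phase-space incompressibility underlies the advection of the distribution function as a density and the conservation of the Casimir functionals.) -/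
noncomputable section

/-- The trace of an endomorphism of a product is the sum of the traces of its diagonal blocks. -/
theorem LinearMap.trace_eq_trace_fst_add_trace_snd {R M N : Type*} [CommRing R]
    [AddCommGroup M] [Module R M] [Module.Free R M] [Module.Finite R M]
    [AddCommGroup N] [Module R N] [Module.Free R N] [Module.Finite R N]
    (T : M × N →ₗ[R] M × N) :
    LinearMap.trace R (M × N) T =
      LinearMap.trace R M (LinearMap.fst R M N ∘ₗ T ∘ₗ LinearMap.inl R M N) +
      LinearMap.trace R N (LinearMap.snd R M N ∘ₗ T ∘ₗ LinearMap.inr R M N) := by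
  have hT : T = (T ∘ₗ LinearMap.inl R M N) ∘ₗ LinearMap.fst R M N +
      (T ∘ₗ LinearMap.inr R M N) ∘ₗ LinearMap.snd R M N := by
    ext <;> simp [Prod.mk_zero_zero]
  conv_lhs => rw [hT]
  rw [map_add, LinearMap.trace_comp_comm', LinearMap.trace_comp_comm' (LinearMap.snd R M N)]

/-- The cross product as a bilinear map. -/
def crossBilin : R3 →ₗ[ℝ] R3 →ₗ[ℝ] R3 :=
  LinearMap.mk₂ ℝ cross
    (fun a b c => by ext i; fin_cases i <;> simp [cross] <;> ring)
    (fun r a b => by ext i; fin_cases i <;> simp [cross] <;> ring)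
    (fun a b c => by ext i; fin_cases i <;> simp [cross] <;> ring)
    (fun r a b => by ext i; fin_cases i <;> simp [cross] <;> ring)

@[simp]
theorem crossBilin_apply (a b : R3) : crossBilin a b = cross a b := rfl

/-- The cross product as a continuous bilinear map. -/
def crossCLM : R3 →L[ℝ] R3 →L[ℝ] R3 :=
  LinearMap.toContinuousLinearMap
    (LinearMap.toContinuousLinearMap.toLinearMap ∘ₗ crossBilin)

@[simp]
theorem crossCLM_apply (a b : R3) : crossCLM a b = cross a b := rfl

@[simp]
theorem cross_zero_right (a : R3) : cross a 0 = 0 := map_zero (crossBilin a)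

theorem trace_crossBilin_flip (b : R3) : LinearMap.trace ℝ R3 (crossBilin.flip b) = 0 := by
  rw [LinearMap.trace_eq_matrix_trace ℝ (EuclideanSpace.basisFun (Fin 3) ℝ).toBasis]
  simp [Matrix.trace, Fin.sum_univ_three, LinearMap.toMatrix_apply, cross]

theorem hasFDerivAt_lorentz_field {E B : R3 → R3} {x : R3}
    (hE : DifferentiableAt ℝ E x) (hB : DifferentiableAt ℝ B x) (v : R3) :
    HasFDerivAt (fun z : R3 × R3 => (z.2, E z.1 + cross z.2 (B z.1)))
      ((ContinuousLinearMap.snd ℝ R3 R3).prod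
        ((fderiv ℝ E x).comp (ContinuousLinearMap.fst ℝ R3 R3) +
          (crossCLM.precompR (R3 × R3) v
              ((fderiv ℝ B x).comp (ContinuousLinearMap.fst ℝ R3 R3)) +
            crossCLM.precompL (R3 × R3) (ContinuousLinearMap.snd ℝ R3 R3) (B x))))
      (x, v) := by
  have h₁ : HasFDerivAt (fun z : R3 × R3 => z.1) (ContinuousLinearMap.fst ℝ R3 R3) (x, v) :=
    hasFDerivAt_fst
  have h₂ : HasFDerivAt (fun z : R3 × R3 => z.2) (ContinuousLinearMap.snd ℝ R3 R3) (x, v) :=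
    hasFDerivAt_snd
  have hE' : HasFDerivAt (fun z : R3 × R3 => E z.1)
      ((fderiv ℝ E x).comp (ContinuousLinearMap.fst ℝ R3 R3)) (x, v) :=
    HasFDerivAt.comp (x, v) (f := fun z : R3 × R3 => z.1) hE.hasFDerivAt h₁
  have hB' : HasFDerivAt (fun z : R3 × R3 => B z.1)
      ((fderiv ℝ B x).comp (ContinuousLinearMap.fst ℝ R3 R3)) (x, v) :=
    HasFDerivAt.comp (x, v) (f := fun z : R3 × R3 => z.1) hB.hasFDerivAt h₁
  have hc := crossCLM.hasFDerivAt_of_bilinear h₂ hB'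
  simp only [crossCLM_apply] at hc
  exact h₂.prodMk (hE'.add hc)

/-- The Lorentz-force phase-space vector field
`X(x,v) = (v, E(x) + v × B(x))` is differentiable at every point and divergence-free:
the trace of its Fréchet derivative, as a linear endomorphism of `ℝ³ × ℝ³ ≅ ℝ⁶`,
vanishes everywhere. -/
theorem lorentz_field_divergence_free
    (E B : R3 → R3) (hE : Differentiable ℝ E) (hB : Differentiable ℝ B) :
    ∀ x v : R3,
      DifferentiableAt ℝ (fun z : R3 × R3 => (z.2, E z.1 + cross z.2 (B z.1))) (x, v) ∧
      LinearMap.trace ℝ (R3 × R3)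
        ((fderiv ℝ (fun z : R3 × R3 => (z.2, E z.1 + cross z.2 (B z.1)))
            (x, v)).toLinearMap) = 0 := by
  intro x v
  have h := hasFDerivAt_lorentz_field (hE x) (hB x) v
  refine ⟨h.differentiableAt, ?_⟩
  rw [h.fderiv, LinearMap.trace_eq_trace_fst_add_trace_snd, ← add_zero (0 : ℝ)]
  congr 1
  · convert map_zero (LinearMap.trace ℝ R3)
    ext
    simp
  · convert trace_crossBilin_flip (B x) using 2
    ext
    simp [ContinuousLinearMap.precompR, ContinuousLinearMap.precompL]
end
end

section
/- Let E be a finite-dimensional real normed space and φ : ℝ → E → E a flow (φ 0 z = z, φ (s+t) z = φ s (φ t z), t ↦ φ t z continuous for every z) with equilibrium z₀ (φ t z₀ = z₀ for all t). Let H, B₁, …, B_m : E → ℝ and u* ∈ ℝᵐ, and define the controlled energy–Casimir functional 𝓔 := H + Σ_{a=1}^m u*_a B_a. Assume 𝓔 is twice continuously differentiable, conserved along the flow (𝓔 (φ t z) = 𝓔 z for all t, z), z₀ is a critical point of 𝓔 (fderiv ℝ 𝓔 z₀ = 0), and the second derivative of 𝓔 at z₀ is positive definite: (iteratedFDeriv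 ℝ 2 𝓔 z₀)(h,h) > 0 for every h ≠ 0. Then z₀ is Lyapunov stable for φ: for every ε > 0 there exists δ > 0 such that ‖z − z₀‖ < δ implies ‖φ t z − z₀‖ < ε for all t ∈ ℝ. (Finite-dimensional form of the Controlled Symmetry Breaking and Effective Stabilization Theorem: shifting the equilibrium onto a controlled energy–Casimir critical point with positive-definite second variation yields stability.) -/
noncomputable section

open Set Metric

section

variable {E : Type*} [NormedAddCommGroup E] [NormedSpace ℝ E] [FiniteDimensional ℝ E]

/-- A positive definite continuous bilinear form on a finite-dimensional space is coercive. -/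
theorem ContinuousLinearMap.exists_pos_mul_sq_norm_le (B : E →L[ℝ] E →L[ℝ] ℝ)
    (hB : ∀ h : E, h ≠ 0 → 0 < B h h) : ∃ c > 0, ∀ h : E, c * ‖h‖ ^ 2 ≤ B h h := by
  obtain ⟨c, hc, hle⟩ := (isCompact_sphere (0 : E) 1).exists_forall_le' (f := fun h => B h h)
    (a := 0) (by fun_prop) fun h hh => hB h (ne_zero_of_mem_unit_sphere ⟨h, hh⟩)
  refine ⟨c, hc, fun h => ?_⟩
  rcases eq_or_ne h 0 with rfl | hne
  · simp
  have hn : 0 < ‖h‖ := norm_pos_iff.mpr hne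
  have key := hle (‖h‖⁻¹ • h) (by simp [norm_smul, hn.ne'])
  simp only [map_smul, smul_apply, smul_eq_mul] at key
  calc c * ‖h‖ ^ 2 ≤ (‖h‖⁻¹ * (‖h‖⁻¹ * B h h)) * ‖h‖ ^ 2 := by gcongr
    _ = B h h := by field_simp

/-- Second derivative test: a critical point with positive definite second derivative is a strict
local minimum. -/
theorem exists_pos_forall_lt_of_fderiv_eq_zero_of_fderiv_fderiv_pos {f : E → ℝ} {x : E}
    (hf : Differentiable ℝ f) (hf' : DifferentiableAt ℝ (fderiv ℝ f) x)
    (hcrit : fderiv ℝ f x = 0) (hpos : ∀ h : E, h ≠ 0 → 0 < fderiv ℝ (fderiv ℝ f) x h h) :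
    ∃ r > 0, ∀ z ∈ ball x r, z ≠ x → f x < f z := by
  obtain ⟨c, hc, hcoer⟩ := (fderiv ℝ (fderiv ℝ f) x).exists_pos_mul_sq_norm_le hpos
  obtain ⟨r, hr, hball⟩ := Metric.eventually_nhds_iff_ball.mp
    (hf'.hasFDerivAt.isLittleO.def (half_pos hc))
  have radial_pos : ∀ w ∈ ball x r, w ≠ x → 0 < fderiv ℝ f w (w - x) := by
    intro w hw hne
    have hn : 0 < ‖w - x‖ := norm_pos_iff.mpr (sub_ne_zero.mpr hne)
    have h1 := hball w hw
    rw [hcrit, sub_zero] at h1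
    have h2 := (ContinuousLinearMap.le_opNorm _ (w - x)).trans
      (mul_le_mul_of_nonneg_right h1 (norm_nonneg _))
    rw [sub_apply, Real.norm_eq_abs] at h2
    have h3 := (abs_le.mp h2).1
    have h4 := hcoer (w - x)
    nlinarith [mul_pos hc (pow_pos hn 2)]
  refine ⟨r, hr, fun z hz hne => ?_⟩
  have hderiv : ∀ t : ℝ, HasDerivAt (fun t : ℝ => f (x + t • (z - x)))
      (fderiv ℝ f (x + t • (z - x)) (z - x)) t := fun t => by
    have h1 : HasDerivAt (fun t : ℝ => x + t • (z - x)) (z - x) t := by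
      simpa using ((hasDerivAt_id t).smul_const (z - x)).const_add x
    exact (hf _).hasFDerivAt.comp_hasDerivAt t h1
  obtain ⟨t, ⟨ht0, ht1⟩, ht⟩ := exists_hasDerivAt_eq_slope _ _ one_pos
    (fun t _ => (hderiv t).continuousAt.continuousWithinAt) fun t _ => hderiv t
  have hsub : z - x ≠ 0 := sub_ne_zero.mpr hne
  have hmem : x + t • (z - x) ∈ ball x r := by
    rw [mem_ball_iff_norm] at hz ⊢
    rw [add_sub_cancel_left, norm_smul, Real.norm_of_nonneg ht0.le]
    exact (mul_le_of_le_one_left (norm_nonneg _) ht1.le).trans_lt hz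
  have h5 := radial_pos _ hmem (by simp [ht0.ne', hsub])
  rw [add_sub_cancel_left, map_smul, smul_eq_mul] at h5
  have h6 := pos_of_mul_pos_right h5 ht0.le
  rw [ht] at h6
  simpa using h6

/-- Lyapunov's direct method: a continuous function that is constant along continuous curves
`t ↦ φ t z` starting at `z`, with a strict local minimum at `x`, forces stability of `x`. -/
theorem lyapunov_stable_of_strict_local_min {φ : ℝ → E → E} (hφ0 : ∀ z, φ 0 z = z)
    (hφcont : ∀ z, Continuous fun t => φ t z) {f : E → ℝ} (hf : Continuous f)
    (hcons : ∀ t z, f (φ t z) = f z) {x : E} {r : ℝ} (hr : 0 < r)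
    (hmin : ∀ z ∈ ball x r, z ≠ x → f x < f z) :
    ∀ ε > 0, ∃ δ > 0, ∀ z : E, ‖z - x‖ < δ → ∀ t : ℝ, ‖φ t z - x‖ < ε := by
  intro ε hε
  obtain ⟨ρ, hρ, hρlt⟩ := exists_between (lt_min hr hε)
  obtain ⟨hρr, hρε⟩ := lt_min_iff.mp hρlt
  obtain ⟨b, hb, hle⟩ := (isCompact_sphere x ρ).exists_forall_le' hf.continuousOn
    fun z hz => hmin z (sphere_subset_ball hρr hz) (ne_of_mem_sphere hz hρ.ne')
  obtain ⟨η, hη, hlt⟩ := Metric.eventually_nhds_iff_ball.mp (hf.continuousAt.eventually_lt_const hb)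
  refine ⟨min η ρ, lt_min hη hρ, fun z hz t => ?_⟩
  obtain ⟨hzη, hzρ⟩ := lt_min_iff.mp hz
  refine lt_of_not_ge fun hge => ?_
  obtain ⟨s, hs⟩ := mem_range_of_exists_le_of_exists_ge ((hφcont z).sub continuous_const).norm
    ⟨0, by simpa [hφ0] using hzρ.le⟩ ⟨t, hρε.le.trans hge⟩
  have h1 := hle (φ s z) (mem_sphere_iff_norm.mpr hs)
  rw [hcons] at h1
  exact h1.not_gt (hlt z (mem_ball_iff_norm.mpr hzη))

end

/-- Controlled Symmetry Breaking and Effective Stabilization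
(finite-dimensional form).  Let `φ` be a flow on a finite-dimensional real normed space with
equilibrium `z₀`, and let `𝓔 = H + Σ_a u*_a B_a` be the controlled energy–Casimir functional.
If `𝓔` is `C²`, conserved along the flow, has a critical point at `z₀`, and its second
derivative at `z₀` is positive definite, then `z₀` is Lyapunov stable for `φ`. -/
theorem controlled_energy_casimir_stabilization
    {E : Type*} [NormedAddCommGroup E] [NormedSpace ℝ E] [FiniteDimensional ℝ E]
    (φ : ℝ → E → E)
    (hφ0 : ∀ z : E, φ 0 z = z)
    (hφadd : ∀ (s t : ℝ) (z : E), φ (s + t) z = φ s (φ t z))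
    (hφcont : ∀ z : E, Continuous fun t => φ t z)
    (z₀ : E) (heq : ∀ t : ℝ, φ t z₀ = z₀)
    {m : ℕ} (H : E → ℝ) (Bs : Fin m → E → ℝ) (ustar : Fin m → ℝ)
    (hEC : ContDiff ℝ 2 (fun z => H z + ∑ a, ustar a * Bs a z))
    (hcons : ∀ (t : ℝ) (z : E),
      (H (φ t z) + ∑ a, ustar a * Bs a (φ t z)) = H z + ∑ a, ustar a * Bs a z)
    (hcrit : fderiv ℝ (fun z => H z + ∑ a, ustar a * Bs a z) z₀ = 0)
    (hpos : ∀ h : E, h ≠ 0 →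
      0 < iteratedFDeriv ℝ 2 (fun z => H z + ∑ a, ustar a * Bs a z) z₀ ![h, h]) :
    ∀ ε > 0, ∃ δ > 0, ∀ z : E, ‖z - z₀‖ < δ → ∀ t : ℝ, ‖φ t z - z₀‖ < ε := by
  obtain ⟨r, hr, hmin⟩ := exists_pos_forall_lt_of_fderiv_eq_zero_of_fderiv_fderiv_pos
    (hEC.differentiable (by norm_num))
    ((hEC.fderiv_right (m := 1) (by norm_num)).differentiable (by norm_num) z₀) hcrit
    fun h hh => by simpa [iteratedFDeriv_two_apply] using hpos h hh
  exact lyapunov_stable_of_strict_local_min hφ0 hφcont hEC.continuous hcons hr hmin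
end
end
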